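/- Let n, p, s be positive integers with 2s ≤ p, let X be an n×p real matrix each of whose columns has ℓ₂-norm √n, let β ∈ ℝ^p have at most s nonzero coordinates with support S, let ε ∈ ℝⁿ and Y = Xβ + ε. Fix σ > 0, a ≥ 0, set λ = √(2·log p/n), and assume the noise event ‖Xᵀε/n‖_∞ ≤ σ√(1+a)·λ holds. Let s₀ ≥ 1 be the essential sparsity of β. Assume X satisfies RE(s₀,k₀,X) with constants K(s₀,k₀) for k₀ = 1, 3, 4, and that Λ_max(2s) < ∞ and Λ_min(2s) > 0. Let β_init be a Lasso minimizer with penalty λ_n = d₀λσ, where d₀ ≥ 2√(1+a). Define ℓ(s₀) = min(θ_{s₀,2s₀}/√Λ_min(2s₀), √Λ_max(s₀)), D = √(Λ_max(s−s₀)/Λ_min(2s₀))·(1 + 3·ℓ(s₀)·√Λ_max(s−s₀)/d₀), D₀′ = max{D, d₀·K(s₀,4)², K(s₀,3)·√Λ_max(s−s₀) + 3d₀·K(s₀,3)²}, and D₁ = max{Λ_max(s−s₀)/d₀ + (9/4)·d₀·K(s₀,3)², 4d₀·K(s₀,4)², 3Λ_max(s−s₀)/d₀}. Choose C₄ ≥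 max(D₁, 2√(1+a)), set t₀ = C₄λσ and I = {j : |β_init,j| ≥ t₀}, and let β̂ = β̂^ols(I) be the OLS refit of Y on the columns indexed by I. Then |I| ≤ s₀(1 + D₁/C₄) ≤ 2s₀, |I ∪ S| ≤ s + s₀, and ‖β̂ − β‖₂² ≤ ((D₀′ + C₄)² + 1)·(3/2 + (Λ_max(2s) − Λ_min(2s))²/(2·Λ_min(2s₀)²))·s₀λ²σ². -/

import Mathlib

open Finset Matrix Real
open scoped BigOperators Classical

noncomputable section

namespace ThreshLasso

/-- ℓ₂ norm of a finite real vector. -/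
def l2 {m : ℕ} (v : Fin m → ℝ) : ℝ := Real.sqrt (∑ i, (v i) ^ 2)

/-- ℓ₁ norm of a finite real vector. -/
def l1 {m : ℕ} (v : Fin m → ℝ) : ℝ := ∑ i, |v i|

/-- Restriction of a vector to a set of coordinates (zero outside). -/
def restr {p : ℕ} (v : Fin p → ℝ) (T : Finset (Fin p)) : Fin p → ℝ :=
  fun j => if j ∈ T then v j else 0

/-- Support of a vector, as a `Finset`. -/
def supp {p : ℕ} (v : Fin p → ℝ) : Finset (Fin p) :=
  Finset.univ.filter fun j => v j ≠ 0

/-- `L` is the minimal `m`-sparse eigenvalue `Λ_min(m)` of `X`: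
the least value of `‖Xv‖₂²/(n‖v‖₂²)` over nonzero `v` with at most `m`
nonzero coordinates. -/
def IsLambdaMin {n p : ℕ} (X : Matrix (Fin n) (Fin p) ℝ) (m : ℕ) (L : ℝ) : Prop :=
  IsLeast {r : ℝ | ∃ v : Fin p → ℝ, v ≠ 0 ∧ (supp v).card ≤ m ∧
    r = (l2 (X.mulVec v)) ^ 2 / (n * (l2 v) ^ 2)} L

/-- `L` is the maximal `m`-sparse eigenvalue `Λ_max(m)` of `X`
(with the convention `Λ_max(0) = 0`, implemented by inserting `0` in the set,
which does not change the maximum when `m ≥ 1`). -/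
def IsLambdaMax {n p : ℕ} (X : Matrix (Fin n) (Fin p) ℝ) (m : ℕ) (L : ℝ) : Prop :=
  IsGreatest (insert (0 : ℝ) {r : ℝ | ∃ v : Fin p → ℝ, v ≠ 0 ∧ (supp v).card ≤ m ∧
    r = (l2 (X.mulVec v)) ^ 2 / (n * (l2 v) ^ 2)}) L

/-- `θ` is the restricted orthogonality constant `θ_{m,m'}` of `X`: the smallest
nonnegative `t` such that `|⟨Xu, Xu'⟩|/n ≤ t‖u‖₂‖u'‖₂` for all `u, u'` supported
on disjoint sets of cardinality at most `m`, `m'` respectively. -/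
def IsTheta {n p : ℕ} (X : Matrix (Fin n) (Fin p) ℝ) (m m' : ℕ) (θ : ℝ) : Prop :=
  IsLeast {t : ℝ | 0 ≤ t ∧ ∀ (u u' : Fin p → ℝ) (T T' : Finset (Fin p)),
    Disjoint T T' → T.card ≤ m → T'.card ≤ m' →
    (∀ j, j ∉ T → u j = 0) → (∀ j, j ∉ T' → u' j = 0) →
    |∑ i, (X.mulVec u i) * (X.mulVec u' i)| / n ≤ t * (l2 u * l2 u')} θ

/-- Restricted eigenvalue condition `RE(s₀, k₀, X)` with constant `K`. -/
def RECond {n p : ℕ} (X : Matrix (Fin n) (Fin p) ℝ) (s₀ : ℕ) (k₀ K : ℝ) : Prop :=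
  0 < K ∧ ∀ (v : Fin p → ℝ) (J : Finset (Fin p)), J.card ≤ s₀ →
    l1 (restr v Jᶜ) ≤ k₀ * l1 (restr v J) →
    l2 (restr v J) / K ≤ l2 (X.mulVec v) / Real.sqrt n

/-- `s₀` is the essential sparsity of `β`: the smallest nonnegative integer `m`
with `∑ᵢ min(βᵢ², λ²σ²) ≤ m λ²σ²`. -/
def EssSparsity {p : ℕ} (β : Fin p → ℝ) (lam σ : ℝ) (s₀ : ℕ) : Prop :=
  IsLeast {m : ℕ | ∑ i, min ((β i) ^ 2) (lam ^ 2 * σ ^ 2) ≤ (m : ℝ) * (lam ^ 2 * σ ^ 2)} s₀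

/-- `T₀` is a set of indices of the `s₀` largest coordinates of `β` in absolute value. -/
def TopSet {p : ℕ} (β : Fin p → ℝ) (s₀ : ℕ) (T₀ : Finset (Fin p)) : Prop :=
  T₀.card = s₀ ∧ ∀ i ∈ T₀, ∀ j, j ∉ T₀ → |β j| ≤ |β i|

/-- `T₁` is a set of indices of the `s₀` largest coordinates of `h` in absolute
value outside `T₀`. -/
def TopSetOutside {p : ℕ} (h : Fin p → ℝ) (s₀ : ℕ) (T₀ T₁ : Finset (Fin p)) : Prop :=
  T₁.card = s₀ ∧ Disjoint T₀ T₁ ∧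
    ∀ i ∈ T₁, ∀ j, j ∉ T₀ → j ∉ T₁ → |h j| ≤ |h i|

/-- `b` is a Lasso minimizer with penalty `lamn` for data `(X, Y)`. -/
def IsLassoSol {n p : ℕ} (X : Matrix (Fin n) (Fin p) ℝ) (Y : Fin n → ℝ)
    (lamn : ℝ) (b : Fin p → ℝ) : Prop :=
  ∀ b' : Fin p → ℝ,
    1 / (2 * n) * (l2 (Y - X.mulVec b)) ^ 2 + lamn * l1 b ≤
    1 / (2 * n) * (l2 (Y - X.mulVec b')) ^ 2 + lamn * l1 b'

/-- Submatrix of the columns of `X` indexed by `I`. -/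
def colSub {n p : ℕ} (X : Matrix (Fin n) (Fin p) ℝ) (I : Finset (Fin p)) :
    Matrix (Fin n) {j // j ∈ I} ℝ :=
  Matrix.of fun i j => X i j.1

/-- The Gram matrix `X_Iᵀ X_I` is invertible. -/
def GramInvertible {n p : ℕ} (X : Matrix (Fin n) (Fin p) ℝ) (I : Finset (Fin p)) : Prop :=
  IsUnit ((colSub X I)ᵀ * colSub X I).det

/-- The OLS refit of `Y` on the columns of `X` indexed by `I`:
`(X_Iᵀ X_I)⁻¹ X_Iᵀ Y` on `I`, and `0` off `I`. -/
def olsRefit {n p : ℕ} (X : Matrix (Fin n) (Fin p) ℝ) (Y : Fin n → ℝ)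
    (I : Finset (Fin p)) : Fin p → ℝ :=
  fun j => if h : j ∈ I then
    (((colSub X I)ᵀ * colSub X I)⁻¹).mulVec ((colSub X I)ᵀ.mulVec Y) ⟨j, h⟩
  else 0

lemma l2_nonneg {m : ℕ} (v : Fin m → ℝ) : 0 ≤ l2 v := Real.sqrt_nonneg _

lemma l2_sq {m : ℕ} (v : Fin m → ℝ) : l2 v ^ 2 = ∑ i, v i ^ 2 :=
  Real.sq_sqrt (Finset.sum_nonneg fun _ _ => sq_nonneg _)

lemma l2_sq_eq_dotProduct {m : ℕ} (v : Fin m → ℝ) : l2 v ^ 2 = v ⬝ᵥ v := by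
  rw [l2_sq]
  exact Finset.sum_congr rfl fun i _ => sq (v i)

lemma l2_eq_zero {m : ℕ} {v : Fin m → ℝ} (h : l2 v = 0) : v = 0 := by
  have h2 := l2_sq_eq_dotProduct v
  rw [h] at h2
  exact dotProduct_self_eq_zero.1 (by simpa using h2.symm)

lemma dotProduct_le_l2_mul_l2 {m : ℕ} (u v : Fin m → ℝ) : u ⬝ᵥ v ≤ l2 u * l2 v :=
  Real.sum_mul_le_sqrt_mul_sqrt _ _ _

lemma l2_add_le {m : ℕ} (u v : Fin m → ℝ) : l2 (u + v) ≤ l2 u + l2 v := by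
  refine le_of_sq_le_sq ?_ (add_nonneg (l2_nonneg u) (l2_nonneg v))
  have h := dotProduct_le_l2_mul_l2 u v
  have : l2 (u + v) ^ 2 = l2 u ^ 2 + 2 * (u ⬝ᵥ v) + l2 v ^ 2 := by
    simp only [l2_sq_eq_dotProduct, add_dotProduct, dotProduct_add, dotProduct_comm v u]
    ring
  nlinarith

lemma l2_neg {m : ℕ} (v : Fin m → ℝ) : l2 (-v) = l2 v := by simp [l2]

lemma restr_add_restr_sdiff {p : ℕ} (v : Fin p → ℝ) {S T : Finset (Fin p)}
    (h : S ⊆ T) : restr v S + restr v (T \ S) = restr v T := by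
  funext j
  by_cases h1 : j ∈ S
  · simp [restr, h1, h h1]
  · simp [restr, h1]

lemma restr_add_restr_compl {p : ℕ} (v : Fin p → ℝ) (T : Finset (Fin p)) :
    restr v T + restr v Tᶜ = v := by
  funext j
  by_cases h : j ∈ T <;> simp [restr, h]

lemma l2_restr_sq {p : ℕ} (v : Fin p → ℝ) (T : Finset (Fin p)) :
    l2 (restr v T) ^ 2 = ∑ j ∈ T, v j ^ 2 := by
  simp [l2_sq, restr, ite_pow, Finset.sum_ite_mem]

lemma l1_restr {p : ℕ} (v : Fin p → ℝ) (T : Finset (Fin p)) :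
    l1 (restr v T) = ∑ j ∈ T, |v j| := by
  simp [l1, restr, apply_ite abs, Finset.sum_ite_mem]

lemma l1_eq_restr_add {p : ℕ} (v : Fin p → ℝ) (T : Finset (Fin p)) :
    l1 v = l1 (restr v T) + l1 (restr v Tᶜ) := by
  simp only [l1_restr, Finset.sum_add_sum_compl]
  rfl

lemma l2_sq_eq_restr_add {p : ℕ} (v : Fin p → ℝ) (T : Finset (Fin p)) :
    l2 v ^ 2 = l2 (restr v T) ^ 2 + l2 (restr v Tᶜ) ^ 2 := by
  rw [l2_restr_sq, l2_restr_sq, Finset.sum_add_sum_compl, l2_sq]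

lemma l1_nonneg {m : ℕ} (v : Fin m → ℝ) : 0 ≤ l1 v :=
  Finset.sum_nonneg fun _ _ => abs_nonneg _

lemma l1_restr_le {p : ℕ} (v : Fin p → ℝ) (T : Finset (Fin p)) :
    l1 (restr v T) ≤ Real.sqrt T.card * l2 (restr v T) := by
  refine le_of_sq_le_sq ?_ (mul_nonneg (Real.sqrt_nonneg _) (l2_nonneg _))
  rw [l1_restr, mul_pow, Real.sq_sqrt (Nat.cast_nonneg _), l2_restr_sq]
  simpa using sq_sum_le_card_mul_sum_sq (s := T) (f := fun j => |v j|)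

lemma supp_subset {p : ℕ} {v : Fin p → ℝ} {T : Finset (Fin p)}
    (h : ∀ j, j ∉ T → v j = 0) : supp v ⊆ T := by
  intro j hj
  by_contra hjT
  exact (Finset.mem_filter.1 hj).2 (h j hjT)

lemma eq_zero_of_notMem_supp {p : ℕ} {v : Fin p → ℝ} {j : Fin p} (h : j ∉ supp v) : v j = 0 := by
  simpa [supp] using h

lemma restr_of_notMem {p : ℕ} (v : Fin p → ℝ) {T : Finset (Fin p)} {j : Fin p} (h : j ∉ T) :
    restr v T j = 0 := by simp [restr, h]

lemma card_supp_restr_le {p : ℕ} (v : Fin p → ℝ) (T : Finset (Fin p)) :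
    (supp (restr v T)).card ≤ T.card :=
  Finset.card_le_card (supp_subset fun _ => restr_of_notMem v)

lemma IsLambdaMin.mul_le {n p : ℕ} (hn : 0 < n) {X : Matrix (Fin n) (Fin p) ℝ} {m : ℕ} {L : ℝ}
    (hL : IsLambdaMin X m L) {v : Fin p → ℝ} (hv : (supp v).card ≤ m) :
    L * l2 v ^ 2 ≤ l2 (X *ᵥ v) ^ 2 / n := by
  have hn' : (0 : ℝ) < n := Nat.cast_pos.2 hn
  by_cases h0 : v = 0
  · subst h0
    simp [l2]
  · have hpos : 0 < l2 v := (l2_nonneg v).lt_of_ne' fun h => h0 (l2_eq_zero h)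
    have := hL.2 ⟨v, h0, hv, rfl⟩
    rw [le_div_iff₀ (by positivity)] at this
    rw [le_div_iff₀ hn']
    linarith

lemma IsLambdaMax.le_mul {n p : ℕ} (hn : 0 < n) {X : Matrix (Fin n) (Fin p) ℝ} {m : ℕ} {L : ℝ}
    (hL : IsLambdaMax X m L) {v : Fin p → ℝ} (hv : (supp v).card ≤ m) :
    l2 (X *ᵥ v) ^ 2 / n ≤ L * l2 v ^ 2 := by
  have hn' : (0 : ℝ) < n := Nat.cast_pos.2 hn
  by_cases h0 : v = 0
  · subst h0
    simp [l2]
  · have hpos : 0 < l2 v := (l2_nonneg v).lt_of_ne' fun h => h0 (l2_eq_zero h)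
    have := hL.2 (Set.mem_insert_of_mem _ ⟨v, h0, hv, rfl⟩)
    rw [div_le_iff₀ (by positivity)] at this
    rw [div_le_iff₀ hn']
    linarith

lemma IsLambdaMax.nonneg {n p : ℕ} {X : Matrix (Fin n) (Fin p) ℝ} {m : ℕ} {L : ℝ}
    (hL : IsLambdaMax X m L) : 0 ≤ L := hL.2 (Set.mem_insert _ _)

/-- Any finite set has a subset of prescribed size carrying the largest values of `f`. -/
lemma exists_top_subset {ι : Type*} [DecidableEq ι] (f : ι → ℝ) (U : Finset ι) {k : ℕ} (hk : k ≤ U.card) :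
    ∃ V ⊆ U, V.card = k ∧ ∀ i ∈ V, ∀ j ∈ U \ V, f j ≤ f i := by
  induction k with
  | zero => exact ⟨∅, by simp⟩
  | succ k ih =>
    obtain ⟨V, hVU, hVk, hV⟩ := ih (by omega)
    have hne : (U \ V).Nonempty := by
      rw [← Finset.card_pos, Finset.card_sdiff_of_subset hVU]
      omega
    obtain ⟨m, hm, hmax⟩ := Finset.exists_max_image _ f hne
    have hm' := Finset.mem_sdiff.1 hm
    refine ⟨insert m V, Finset.insert_subset hm'.1 hVU, ?_, ?_⟩
    · rw [Finset.card_insert_of_notMem hm'.2, hVk]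
    · intro i hi j hj
      have hj' : j ∈ U \ V := by
        simp only [Finset.mem_sdiff, Finset.mem_insert, not_or] at hj ⊢
        exact ⟨hj.1, hj.2.2⟩
      rcases Finset.mem_insert.1 hi with rfl | hi
      · exact hmax j hj'
      · exact hV i hi j hj'

lemma sum_le_sum_of_card_le {ι : Type*} {f : ι → ℝ} {R J : Finset ι} (hf : ∀ i, 0 ≤ f i)
    (hc : R.card ≤ J.card) (h : ∀ i ∈ J, ∀ j ∈ R, f j ≤ f i) : ∑ j ∈ R, f j ≤ ∑ i ∈ J, f i := by
  rcases R.eq_empty_or_nonempty with rfl | hne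
  · simpa using Finset.sum_nonneg fun i _ => hf i
  obtain ⟨m, hm, hmax⟩ := Finset.exists_max_image _ f hne
  calc ∑ j ∈ R, f j ≤ R.card • f m := Finset.sum_le_card_nsmul _ _ _ hmax
    _ ≤ J.card • f m := nsmul_le_nsmul_left (hf m) hc
    _ ≤ ∑ i ∈ J, f i := Finset.card_nsmul_le_sum _ _ _ fun i hi => h i hi m hm

/-- Shelling: a subadditive set function controlled by the `ℓ₂` norm on sets of size at most `m`
is controlled by the `ℓ₁` norm on arbitrary sets. -/
lemma shelling_aux {ι : Type*} [DecidableEq ι] (v : ι → ℝ) {m : ℕ} (hm : 0 < m) {c : ℝ} (hc : 0 ≤ c)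
    (F : Finset ι → ℝ) (k : ℕ) : ∀ (U : Finset ι) (M : ℝ), U.card ≤ k →
    (∀ V W, V ⊆ W → W ⊆ U → F W ≤ F V + F (W \ V)) →
    (∀ V ⊆ U, V.card ≤ m → F V ≤ c * Real.sqrt (∑ j ∈ V, v j ^ 2)) →
    0 ≤ M → (∀ j ∈ U, |v j| ≤ M) →
    F U ≤ c * (Real.sqrt m * M + (∑ j ∈ U, |v j|) / Real.sqrt m) := by
  have hm' : 0 < Real.sqrt m := Real.sqrt_pos.2 (Nat.cast_pos.2 hm)
  have small : ∀ (V : Finset ι) (M : ℝ), V.card ≤ m → 0 ≤ M → (∀ j ∈ V, |v j| ≤ M) →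
      Real.sqrt (∑ j ∈ V, v j ^ 2) ≤ Real.sqrt m * M := by
    intro V M hV hM hb
    refine Real.sqrt_le_iff.2 ⟨by positivity, ?_⟩
    rw [mul_pow, Real.sq_sqrt (Nat.cast_nonneg _)]
    calc ∑ j ∈ V, v j ^ 2 ≤ V.card • M ^ 2 :=
          Finset.sum_le_card_nsmul _ _ _ fun j hj => sq_le_sq' (by
            linarith [neg_abs_le (v j), hb j hj]) ((le_abs_self _).trans (hb j hj))
      _ ≤ m * M ^ 2 := by
          rw [nsmul_eq_mul]
          gcongr
  induction k with
  | zero =>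
    intro U M hU _ hb hM hv
    refine (hb U subset_rfl (by omega)).trans (mul_le_mul_of_nonneg_left ?_ hc)
    have : 0 ≤ (∑ j ∈ U, |v j|) / Real.sqrt m := by positivity
    linarith [small U M (by omega) hM hv]
  | succ k ih =>
    intro U M hU hF hb hM hv
    by_cases hUm : U.card ≤ m
    · refine (hb U subset_rfl hUm).trans (mul_le_mul_of_nonneg_left ?_ hc)
      have : 0 ≤ (∑ j ∈ U, |v j|) / Real.sqrt m := by positivity
      linarith [small U M hUm hM hv]
    · obtain ⟨V, hVU, hVm, hV⟩ := exists_top_subset (fun j => |v j|) U (k := m) (by omega)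
      have hne : V.Nonempty := Finset.card_pos.1 (by omega)
      obtain ⟨i₀, hi₀, hmin⟩ := Finset.exists_min_image V (fun j => |v j|) hne
      have hrest := ih (U \ V) |v i₀| (by
          rw [Finset.card_sdiff_of_subset hVU]; omega)
        (fun A B hAB hB => hF A B hAB (hB.trans Finset.sdiff_subset))
        (fun A hA => hb A (hA.trans Finset.sdiff_subset)) (abs_nonneg _)
        (fun j hj => hV i₀ hi₀ j hj)
      have htop := (hb V hVU hVm.le).trans
        (mul_le_mul_of_nonneg_left (small V M hVm.le hM fun j hj => hv j (hVU hj)) hc)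
      have hs : Real.sqrt m * |v i₀| ≤ (∑ j ∈ V, |v j|) / Real.sqrt m := by
        rw [le_div_iff₀ hm', mul_right_comm, Real.mul_self_sqrt (Nat.cast_nonneg _), ← hVm,
          ← nsmul_eq_mul]
        exact Finset.card_nsmul_le_sum _ _ _ hmin
      have hsum := Finset.sum_sdiff (f := fun j => |v j|) hVU
      have key := hF V U hVU subset_rfl
      rw [← hsum, add_div]
      nlinarith [mul_le_mul_of_nonneg_left hs hc]

lemma shelling {ι : Type*} [DecidableEq ι] (v : ι → ℝ) {m : ℕ} (hm : 0 < m) {c : ℝ} (hc : 0 ≤ c)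
    (F : Finset ι → ℝ) {U V : Finset ι} (hVU : V ⊆ U) (hVm : V.card = m)
    (hV : ∀ i ∈ V, ∀ j ∈ U \ V, |v j| ≤ |v i|)
    (hF : ∀ A B, A ⊆ B → B ⊆ U \ V → F B ≤ F A + F (B \ A))
    (hb : ∀ A ⊆ U \ V, A.card ≤ m → F A ≤ c * Real.sqrt (∑ j ∈ A, v j ^ 2)) :
    F (U \ V) ≤ c * ((∑ j ∈ U, |v j|) / Real.sqrt m) := by
  have hm' : 0 < Real.sqrt m := Real.sqrt_pos.2 (Nat.cast_pos.2 hm)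
  obtain ⟨i₀, hi₀, hmin⟩ := Finset.exists_min_image V (fun j => |v j|)
    (Finset.card_pos.1 (by omega))
  have h := shelling_aux v hm hc F _ (U \ V) |v i₀| le_rfl hF hb (abs_nonneg _)
    (hV i₀ hi₀)
  have hs : Real.sqrt m * |v i₀| ≤ (∑ j ∈ V, |v j|) / Real.sqrt m := by
    rw [le_div_iff₀ hm', mul_right_comm, Real.mul_self_sqrt (Nat.cast_nonneg _), ← hVm,
      ← nsmul_eq_mul]
    exact Finset.card_nsmul_le_sum _ _ _ hmin
  refine h.trans (mul_le_mul_of_nonneg_left ?_ hc)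
  rw [← Finset.sum_sdiff hVU, add_div]
  linarith

/-- The variational inequality satisfied by a Lasso minimizer. -/
lemma IsLassoSol.variational {n p : ℕ} {X : Matrix (Fin n) (Fin p) ℝ}
    {Y : Fin n → ℝ} {lamn : ℝ} {b : Fin p → ℝ} (hlam : 0 ≤ lamn) (hb : IsLassoSol X Y lamn b)
    (c : Fin p → ℝ) :
    0 ≤ ((Y - X *ᵥ b) ⬝ᵥ (X *ᵥ (b - c))) / n + lamn * (l1 c - l1 b) := by
  set q := (Y - X *ᵥ b) ⬝ᵥ (X *ᵥ (b - c)) with hq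
  set z := l2 (X *ᵥ (b - c)) ^ 2 with hz
  have key : ∀ t : ℝ, 0 < t → t ≤ 1 →
      0 ≤ q / n + lamn * (l1 c - l1 b) + t * (z / (2 * n)) := by
    intro t ht ht1
    have h1 := hb (b - t • (b - c))
    have h2 : l2 (Y - X *ᵥ (b - t • (b - c))) ^ 2 =
        l2 (Y - X *ᵥ b) ^ 2 + 2 * t * q + t ^ 2 * z := by
      have : Y - X *ᵥ (b - t • (b - c)) = (Y - X *ᵥ b) + t • (X *ᵥ (b - c)) := by
        rw [mulVec_sub, mulVec_smul]
        abel
      rw [this, hz, hq]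
      simp only [l2_sq_eq_dotProduct, add_dotProduct, dotProduct_add, smul_dotProduct,
        dotProduct_smul, smul_eq_mul, dotProduct_comm (X *ᵥ (b - c)) (Y - X *ᵥ b)]
      ring
    have h3 : l1 (b - t • (b - c)) ≤ (1 - t) * l1 b + t * l1 c := by
      unfold l1
      rw [Finset.mul_sum, Finset.mul_sum, ← Finset.sum_add_distrib]
      refine Finset.sum_le_sum fun i _ => ?_
      have : (b - t • (b - c)) i = (1 - t) * b i + t * c i := by
        simp only [Pi.sub_apply, Pi.smul_apply, smul_eq_mul]
        ring
      rw [this]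
      refine (abs_add_le _ _).trans ?_
      rw [abs_mul, abs_mul, abs_of_nonneg (sub_nonneg.2 ht1), abs_of_pos ht]
    rw [h2] at h1
    have h4 : 0 ≤ t * (q / n + lamn * (l1 c - l1 b) + t * (z / (2 * n))) := by
      have h5 := mul_le_mul_of_nonneg_left h3 hlam
      have h6 : 1 / (2 * (n : ℝ)) * (l2 (Y - X *ᵥ b) ^ 2 + 2 * t * q + t ^ 2 * z) =
          1 / (2 * (n : ℝ)) * l2 (Y - X *ᵥ b) ^ 2 + t * (q / n) + t * (t * (z / (2 * n))) := by
        ring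
      rw [h6] at h1
      linarith
    exact nonneg_of_mul_nonneg_right h4 ht
  by_contra! hneg
  set E := q / n + lamn * (l1 c - l1 b) with hE
  set w := z / (2 * (n : ℝ)) with hw
  have hw0 : 0 ≤ w := by positivity
  have hpos : 0 < -E / (2 * (w + 1)) := div_pos (by linarith) (by positivity)
  have h1 := key (min 1 (-E / (2 * (w + 1)))) (lt_min one_pos hpos) (min_le_left _ _)
  have h2 : min 1 (-E / (2 * (w + 1))) * w ≤ -E / (2 * (w + 1)) * w :=
    mul_le_mul_of_nonneg_right (min_le_right _ _) hw0
  have h3 : -E / (2 * (w + 1)) * (2 * (w + 1)) = -E := div_mul_cancel₀ _ (by positivity)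
  nlinarith

lemma dotProduct_mulVec_div_le {n p : ℕ} {X : Matrix (Fin n) (Fin p) ℝ} {ε : Fin n → ℝ} {M : ℝ}
    (h : ∀ j, |(∑ i, X i j * ε i) / n| ≤ M) (u : Fin p → ℝ) :
    (ε ⬝ᵥ (X *ᵥ u)) / n ≤ M * l1 u := by
  rw [dotProduct_mulVec, dotProduct, Finset.sum_div, l1, Finset.mul_sum]
  refine Finset.sum_le_sum fun j _ => ?_
  have h1 : (ε ᵥ* X) j = ∑ i, X i j * ε i := by
    simp only [vecMul, dotProduct, mul_comm]
  rw [h1, mul_div_right_comm]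
  refine (le_abs_self _).trans ?_
  rw [abs_mul]
  exact mul_le_mul_of_nonneg_right (h j) (abs_nonneg _)

lemma dotProduct_div_le {n : ℕ} (u v : Fin n → ℝ) :
    (u ⬝ᵥ v) / n ≤ (l2 u / Real.sqrt n) * (l2 v / Real.sqrt n) := by
  rw [div_mul_div_comm, Real.mul_self_sqrt (Nat.cast_nonneg _)]
  exact div_le_div_of_nonneg_right (dotProduct_le_l2_mul_l2 u v) (Nat.cast_nonneg _)

lemma div_sqrt_sq {n : ℕ} (x : ℝ) : (x / Real.sqrt n) ^ 2 = x ^ 2 / n := by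
  rw [div_pow, Real.sq_sqrt (Nat.cast_nonneg _)]

/-- The basic inequality comparing a Lasso minimizer with the truncation of `β` to `T`. -/
lemma IsLassoSol.basic_inequality {n p : ℕ} {X : Matrix (Fin n) (Fin p) ℝ}
    {β b : Fin p → ℝ} {ε : Fin n → ℝ} {lamn : ℝ} (hlam : 0 ≤ lamn)
    (hb : IsLassoSol X (X *ᵥ β + ε) lamn b)
    (hnoise : ∀ j, |(∑ i, X i j * ε i) / n| ≤ lamn / 2) (T : Finset (Fin p)) :
    2 * (l2 (X *ᵥ (b - restr β T)) / Real.sqrt n) ^ 2 + lamn * l1 (restr (b - restr β T) Tᶜ) ≤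
      3 * lamn * l1 (restr (b - restr β T) T) +
      2 * ((l2 (X *ᵥ (b - restr β T)) / Real.sqrt n) *
        (l2 (X *ᵥ restr β Tᶜ) / Real.sqrt n)) := by
  set h := b - restr β T with hh
  set g := restr β Tᶜ with hg
  have hv := hb.variational hlam (restr β T)
  rw [← hh] at hv
  have hres : X *ᵥ β + ε - X *ᵥ b = X *ᵥ g + ε - X *ᵥ h := by
    rw [hh, mulVec_sub]
    nth_rewrite 1 [← restr_add_restr_compl β T]
    rw [mulVec_add]
    abel
  rw [hres, sub_dotProduct, add_dotProduct, ← l2_sq_eq_dotProduct, sub_div, add_div] at hv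
  have h1 := dotProduct_div_le (X *ᵥ g) (X *ᵥ h)
  have h2 := dotProduct_mulVec_div_le hnoise h
  rw [l1_eq_restr_add h T] at h2
  have h3 : l1 (restr β T) - l1 b ≤ l1 (restr h T) - l1 (restr h Tᶜ) := by
    rw [l1_eq_restr_add b T, l1_restr, l1_restr, l1_restr, l1_restr, l1_restr]
    have e1 : ∑ j ∈ T, |β j| ≤ ∑ j ∈ T, |b j| + ∑ j ∈ T, |h j| := by
      rw [← Finset.sum_add_distrib]
      refine Finset.sum_le_sum fun j hj => ?_
      have : β j = b j - h j := by simp [hh, restr, hj]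
      rw [this]
      exact abs_sub _ _
    have e2 : ∑ j ∈ Tᶜ, |h j| = ∑ j ∈ Tᶜ, |b j| := by
      refine Finset.sum_congr rfl fun j hj => ?_
      simp [hh, restr, Finset.mem_compl.1 hj]
    linarith
  have h4 := mul_le_mul_of_nonneg_left h3 hlam
  rw [div_sqrt_sq]
  linarith

lemma RECond.l2_sq_le {n p : ℕ} {X : Matrix (Fin n) (Fin p) ℝ} {s₀ : ℕ} {k K : ℝ}
    (hRE : RECond X s₀ k K) (hk : 1 ≤ k) {v : Fin p → ℝ} (hv : (supp v).card ≤ 2 * s₀) :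
    l2 v ^ 2 ≤ 2 * K ^ 2 * (l2 (X *ᵥ v) ^ 2 / n) := by
  obtain ⟨J, hJs, hJc, hJ⟩ := exists_top_subset (fun j => |v j|) (supp v)
    (k := min s₀ (supp v).card) (min_le_right _ _)
  have hcard : (supp v \ J).card ≤ J.card := by
    rw [Finset.card_sdiff_of_subset hJs]
    omega
  have hsub : supp v \ J ⊆ Jᶜ := fun j hj => Finset.mem_compl.2 (Finset.mem_sdiff.1 hj).2
  have hzero : ∀ j ∈ Jᶜ, j ∉ supp v \ J → v j = 0 := fun j hj hj' =>
    eq_zero_of_notMem_supp fun h => hj' (Finset.mem_sdiff.2 ⟨h, Finset.mem_compl.1 hj⟩)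
  have h1 : l1 (restr v Jᶜ) ≤ l1 (restr v J) := by
    rw [l1_restr, l1_restr, ← Finset.sum_subset hsub fun j hj hj' => by simp [hzero j hj hj']]
    exact sum_le_sum_of_card_le (fun _ => abs_nonneg _) hcard hJ
  have h2 : l2 (restr v Jᶜ) ^ 2 ≤ l2 (restr v J) ^ 2 := by
    rw [l2_restr_sq, l2_restr_sq,
      ← Finset.sum_subset hsub fun j hj hj' => by simp [hzero j hj hj']]
    exact sum_le_sum_of_card_le (fun _ => sq_nonneg _) hcard
      fun i hi j hj => sq_le_sq.2 (hJ i hi j hj)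
  have h3 := hRE.2 v J (by omega)
    (h1.trans (le_mul_of_one_le_left (l1_nonneg _) hk))
  rw [div_le_iff₀ hRE.1] at h3
  have h4 := pow_le_pow_left₀ (l2_nonneg _) h3 2
  rw [mul_pow, div_sqrt_sq] at h4
  rw [l2_sq_eq_restr_add v J]
  linarith

lemma IsLambdaMin.one_le_mul {n p : ℕ} {X : Matrix (Fin n) (Fin p) ℝ} {s₀ : ℕ}
    {k K L : ℝ} (hRE : RECond X s₀ k K) (hk : 1 ≤ k) (hL : IsLambdaMin X (2 * s₀) L) :
    1 ≤ 2 * K ^ 2 * L := by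
  obtain ⟨v, hv0, hv, rfl⟩ := hL.1
  have hpos : 0 < l2 v := (l2_nonneg v).lt_of_ne' fun h => hv0 (l2_eq_zero h)
  have h := hRE.l2_sq_le hk hv
  rw [← div_div, ← mul_div_assoc, one_le_div (by positivity)]
  exact h

/-- Control of the leading coordinates of `h` through a sparse eigenvalue, when the tail is
handled by restricted orthogonality or by the maximal sparse eigenvalue. -/
lemma sqrt_lambdaMin_mul_l2_restr_le {n p : ℕ} (hn : 0 < n) {X : Matrix (Fin n) (Fin p) ℝ}
    {s₀ : ℕ} (hs₀ : 0 < s₀) (hp : 2 * s₀ ≤ p) {Lmin Lmax θ : ℝ} (hLpos : 0 < Lmin)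
    (hmin : IsLambdaMin X (2 * s₀) Lmin) (hmax : IsLambdaMax X s₀ Lmax)
    (hθ : IsTheta X s₀ (2 * s₀) θ) (h : Fin p → ℝ) {T : Finset (Fin p)} (hT : T.card = s₀) :
    Real.sqrt Lmin * l2 (restr h T) ≤ l2 (X *ᵥ h) / Real.sqrt n +
      min (θ / Real.sqrt Lmin) (Real.sqrt Lmax) * (l1 (restr h Tᶜ) / Real.sqrt s₀) := by
  have hn' : (0 : ℝ) < n := Nat.cast_pos.2 hn
  have hsn : 0 < Real.sqrt n := Real.sqrt_pos.2 hn'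
  have hsL : 0 < Real.sqrt Lmin := Real.sqrt_pos.2 hLpos
  obtain ⟨V, hVT, hVc, hV⟩ := exists_top_subset (fun j => |h j|) Tᶜ (k := s₀) (by
    rw [Finset.card_compl, hT, Fintype.card_fin]; omega)
  set B := Tᶜ \ V with hB
  have hBc : Bᶜ.card ≤ 2 * s₀ := by
    have : Bᶜ = T ∪ V := by ext j; simp [hB]; tauto
    rw [this]
    exact (Finset.card_union_le _ _).trans (by omega)
  have hTB : T ⊆ Bᶜ := fun j hj => by simp [hB, hj]
  set u := restr h Bᶜ with hu
  set w := restr h B with hw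
  have huw : X *ᵥ h = X *ᵥ u + X *ᵥ w := by
    rw [← mulVec_add, add_comm u w, restr_add_restr_compl]
  have hTu : l2 (restr h T) ≤ l2 u := by
    refine le_of_sq_le_sq ?_ (l2_nonneg _)
    rw [l2_restr_sq, l2_restr_sq]
    exact Finset.sum_le_sum_of_subset_of_nonneg hTB fun _ _ _ => sq_nonneg _
  have hlow : Real.sqrt Lmin * l2 u ≤ l2 (X *ᵥ u) / Real.sqrt n := by
    refine le_of_sq_le_sq ?_ (div_nonneg (l2_nonneg _) hsn.le)
    rw [mul_pow, Real.sq_sqrt hLpos.le, div_sqrt_sq]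
    exact hmin.mul_le hn ((card_supp_restr_le _ _).trans hBc)
  have hadd : ∀ A C, A ⊆ C → C ⊆ B → restr h C = restr h A + restr h (C \ A) :=
    fun A C hAC _ => (restr_add_restr_sdiff h hAC).symm
  have hQ : l1 (restr h Tᶜ) / Real.sqrt s₀ = (∑ j ∈ Tᶜ, |h j|) / Real.sqrt s₀ := by
    rw [l1_restr]
  have hQ0 : 0 ≤ l1 (restr h Tᶜ) / Real.sqrt s₀ := div_nonneg (l1_nonneg _) (Real.sqrt_nonneg _)
  have hl2A : ∀ A, Real.sqrt (∑ j ∈ A, h j ^ 2) = l2 (restr h A) := fun A => by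
    rw [← l2_restr_sq, Real.sqrt_sq (l2_nonneg _)]
  have hmaxbd : l2 (X *ᵥ w) / Real.sqrt n ≤
      Real.sqrt Lmax * (l1 (restr h Tᶜ) / Real.sqrt s₀) := by
    rw [hQ]
    refine shelling h hs₀ (Real.sqrt_nonneg _) (fun A => l2 (X *ᵥ restr h A) / Real.sqrt n)
      hVT hVc hV ?_ ?_
    · intro A C hAC hC
      rw [hadd A C hAC hC, mulVec_add, ← add_div]
      exact div_le_div_of_nonneg_right (l2_add_le _ _) hsn.le
    · intro A _ hA
      refine le_of_sq_le_sq ?_ (by positivity)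
      rw [hl2A, mul_pow, Real.sq_sqrt hmax.nonneg, div_sqrt_sq]
      exact hmax.le_mul hn ((card_supp_restr_le _ _).trans hA)
  have hthbd : -((X *ᵥ u) ⬝ᵥ (X *ᵥ w)) / n ≤
      (θ * l2 u) * (l1 (restr h Tᶜ) / Real.sqrt s₀) := by
    rw [hQ]
    refine shelling h hs₀ (mul_nonneg hθ.1.1 (l2_nonneg _))
      (fun A => -((X *ᵥ u) ⬝ᵥ (X *ᵥ restr h A)) / n) hVT hVc hV ?_ ?_
    · intro A C hAC hC
      rw [hadd A C hAC hC, mulVec_add, dotProduct_add, neg_add, add_div]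
    · intro A hA hAc
      have := hθ.1.2 (restr h A) u A Bᶜ (Finset.disjoint_left.2 fun j hj hj' =>
        Finset.mem_compl.1 hj' (hA hj)) hAc hBc (fun _ => restr_of_notMem h)
        (fun _ => restr_of_notMem h)
      rw [hl2A, mul_assoc, mul_comm (l2 u)]
      refine le_trans (div_le_div_of_nonneg_right ?_ hn'.le) this
      rw [dotProduct_comm]
      exact neg_le_abs _
  refine (mul_le_mul_of_nonneg_left hTu hsL.le).trans ?_
  rcases min_cases (θ / Real.sqrt Lmin) (Real.sqrt Lmax) with ⟨hm, -⟩ | ⟨hm, -⟩ <;> rw [hm]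
  · set z := l2 (X *ᵥ u) / Real.sqrt n with hz
    set Q := l1 (restr h Tᶜ) / Real.sqrt s₀
    set x := l2 (X *ᵥ h) / Real.sqrt n
    have h1 : z ^ 2 ≤ x * z + (θ * l2 u) * Q := by
      have e1 := dotProduct_div_le (X *ᵥ h) (X *ᵥ u)
      have e2 : z ^ 2 = ((X *ᵥ h) ⬝ᵥ (X *ᵥ u)) / n + -((X *ᵥ u) ⬝ᵥ (X *ᵥ w)) / n := by
        rw [hz, div_sqrt_sq, l2_sq_eq_dotProduct, huw, add_dotProduct,
          dotProduct_comm (X *ᵥ w)]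
        ring
      linarith
    have h2 : θ * l2 u ≤ θ / Real.sqrt Lmin * z := by
      rw [div_mul_eq_mul_div, le_div_iff₀ hsL, mul_assoc, mul_comm (l2 u)]
      exact mul_le_mul_of_nonneg_left hlow hθ.1.1
    have hz0 : 0 ≤ z := div_nonneg (l2_nonneg _) hsn.le
    rcases hz0.eq_or_lt with h0 | h0
    · have : 0 ≤ x := div_nonneg (l2_nonneg _) hsn.le
      have : 0 ≤ θ / Real.sqrt Lmin * Q := mul_nonneg (div_nonneg hθ.1.1 hsL.le) hQ0
      linarith
    · refine hlow.trans (le_of_mul_le_mul_right ?_ h0)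
      nlinarith [mul_le_mul_of_nonneg_right h2 hQ0]
  · have h1 : l2 (X *ᵥ u) ≤ l2 (X *ᵥ h) + l2 (X *ᵥ w) := by
      have : X *ᵥ u = X *ᵥ h + -(X *ᵥ w) := by rw [huw]; abel
      rw [this, ← l2_neg (X *ᵥ w)]
      exact l2_add_le _ _
    have h2 := div_le_div_of_nonneg_right h1 hsn.le
    rw [add_div] at h2
    linarith

lemma tail_bound_of_basic {x P Q H r μ d E K₃ K₄ D₁ : ℝ}
    (hr : 0 < r) (hμ : 0 < μ) (hd : 0 < d) (hP : P ≤ r * H)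
    (hbasic : 2 * x ^ 2 + d * μ * Q ≤ 3 * (d * μ) * P + 2 * (x * (E * (r * μ))))
    (hK₃ : Q ≤ 3 * P → H ≤ K₃ * x) (hK₄ : Q ≤ 4 * P → H ≤ K₄ * x)
    (h₁ : E ^ 2 / d + (9 / 4) * d * K₃ ^ 2 ≤ D₁) (h₂ : 4 * d * K₄ ^ 2 ≤ D₁)
    (h₃ : 3 * E ^ 2 / d ≤ D₁) : Q ≤ D₁ * (r ^ 2 * μ) := by
  have hdμ : 0 < d * μ := mul_pos hd hμ
  set G := E * (r * μ) with hG
  have g₁ : G ^ 2 + 9 / 4 * (d * μ * r * K₃) ^ 2 ≤ d * μ * (D₁ * (r ^ 2 * μ)) := by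
    have := mul_le_mul_of_nonneg_left h₁ (show 0 ≤ d * μ * (r ^ 2 * μ) by positivity)
    refine le_trans (le_of_eq ?_) (this.trans (le_of_eq (by ring)))
    rw [hG]; field_simp
  have g₂ : 4 * (d * μ * r * K₄) ^ 2 ≤ d * μ * (D₁ * (r ^ 2 * μ)) := by
    have := mul_le_mul_of_nonneg_left h₂ (show 0 ≤ d * μ * (r ^ 2 * μ) by positivity)
    linarith
  have g₃ : 3 * G ^ 2 ≤ d * μ * (D₁ * (r ^ 2 * μ)) := by
    have := mul_le_mul_of_nonneg_left h₃ (show 0 ≤ d * μ * (r ^ 2 * μ) by positivity)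
    refine le_trans (le_of_eq ?_) (this.trans (le_of_eq (by ring)))
    rw [hG]; field_simp
  refine le_of_mul_le_mul_left ?_ hdμ
  rcases le_or_gt Q (3 * P) with hQ | hQ
  · have e := mul_le_mul_of_nonneg_left (hP.trans (mul_le_mul_of_nonneg_left (hK₃ hQ) hr.le))
      hdμ.le
    nlinarith [sq_nonneg (x - G), sq_nonneg (x - 3 / 2 * (d * μ * r * K₃))]
  rcases le_or_gt Q (4 * P) with hQ' | hQ'
  · have e := mul_le_mul_of_nonneg_left (hP.trans (mul_le_mul_of_nonneg_left (hK₄ hQ') hr.le))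
      hdμ.le
    nlinarith [sq_nonneg (4 * x - 3 * (d * μ * r * K₄) - 2 * G),
      sq_nonneg (d * μ * r * K₄ - G)]
  · have e := mul_lt_mul_of_pos_left hQ' hdμ
    nlinarith [sq_nonneg (2 * x - G), sq_nonneg G]

lemma head_bound_of_basic {x P Q H r μ d E K₃ K₄ L l D D₀ : ℝ} (hx : 0 ≤ x) (hQ0 : 0 ≤ Q)
    (hr : 0 < r) (hμ : 0 < μ) (hd : 0 < d) (hE : 0 ≤ E) (hL : 0 < L) (hl : 0 ≤ l)
    (hK₃0 : 0 < K₃) (hK₄0 : 0 < K₄) (hP : P ≤ r * H)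
    (hbasic : 2 * x ^ 2 + d * μ * Q ≤ 3 * (d * μ) * P + 2 * (x * (E * (r * μ))))
    (hK₃ : Q ≤ 3 * P → H ≤ K₃ * x) (hK₄ : Q ≤ 4 * P → H ≤ K₄ * x)
    (hhead : L * H ≤ x + l * (Q / r))
    (hD : D = E / L * (1 + 3 * l * E / d)) (h₁ : D ≤ D₀) (h₂ : d * K₄ ^ 2 ≤ D₀)
    (h₃ : K₃ * E + 3 * d * K₃ ^ 2 ≤ D₀) : H ≤ D₀ * (r * μ) := by
  have hdμ : 0 < d * μ := mul_pos hd hμ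
  have hrμ : 0 < r * μ := mul_pos hr hμ
  set G := E * (r * μ) with hG
  have hG0 : 0 ≤ G := by positivity
  rcases le_or_gt Q (3 * P) with hQ | hQ
  · have e := mul_le_mul_of_nonneg_left (hP.trans (mul_le_mul_of_nonneg_left (hK₃ hQ) hr.le))
      hdμ.le
    have hxb : x ≤ 3 * (d * (r * μ) * K₃) + G := by
      have hw : 0 ≤ d * (r * μ) * K₃ := by positivity
      by_contra! hlt
      nlinarith [mul_nonneg hdμ.le hQ0, mul_nonneg hx hw, mul_nonneg hx hG0]
    have := mul_le_mul_of_nonneg_left hxb hK₃0.le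
    have h4 := mul_le_mul_of_nonneg_right h₃ hrμ.le
    linarith [hK₃ hQ]
  have hxG : x ≤ G := by
    have e := mul_lt_mul_of_pos_left hQ hdμ
    by_contra! hlt
    nlinarith
  have hcase : d * μ * Q ≤ 3 * G ^ 2 → H ≤ D₀ * (r * μ) := by
    intro h
    have hQr : Q / r ≤ 3 * E / d * G := by
      rw [div_le_iff₀ hr]
      refine le_of_mul_le_mul_left (h.trans (le_of_eq ?_)) hdμ
      rw [hG]; field_simp
    have h5 : L * H ≤ G + l * (3 * E / d * G) :=
      hhead.trans (add_le_add hxG (mul_le_mul_of_nonneg_left hQr hl))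
    have h6 : L * (D * (r * μ)) = G + l * (3 * E / d * G) := by
      rw [hD, hG]; field_simp
    have h7 : H ≤ D * (r * μ) := le_of_mul_le_mul_left (h5.trans h6.ge) hL
    exact h7.trans (mul_le_mul_of_nonneg_right h₁ hrμ.le)
  rcases le_or_gt Q (4 * P) with hQ' | hQ'
  · rcases le_or_gt E (d * K₄) with hEd | hEd
    · have h4 := mul_le_mul_of_nonneg_left hxG hK₄0.le
      have h5 := mul_le_mul_of_nonneg_right hEd (mul_pos hK₄0 hrμ).le
      have h6 := mul_le_mul_of_nonneg_right h₂ hrμ.le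
      rw [hG] at h4
      linarith [hK₄ hQ']
    · apply hcase
      have e := mul_le_mul_of_nonneg_left (hP.trans (mul_le_mul_of_nonneg_left (hK₄ hQ') hr.le))
        hdμ.le
      have hw : d * μ * r * K₄ ≤ G := by
        have := mul_le_mul_of_nonneg_right hEd.le hrμ.le
        linarith
      nlinarith [mul_le_mul_of_nonneg_right hw hx,
        mul_nonneg (sub_nonneg.2 hxG) (show 0 ≤ 3 * G - 2 * x by linarith)]
  · apply hcase
    have e := mul_lt_mul_of_pos_left hQ' hdμ
    nlinarith [sq_nonneg (2 * x - G), sq_nonneg G]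

/-- Consequences of essential sparsity for a top set `T` of size `s₀` inside the support. -/
lemma EssSparsity.exists_topSet {p : ℕ} {β : Fin p → ℝ} {lam σ : ℝ} {s₀ : ℕ}
    (hpos : 0 < lam * σ) (hess : EssSparsity β lam σ s₀) :
    ∃ T ⊆ supp β, T.card = s₀ ∧ ∑ j ∈ Tᶜ, β j ^ 2 ≤ s₀ * (lam * σ) ^ 2 := by
  have hsq : lam ^ 2 * σ ^ 2 = (lam * σ) ^ 2 := by ring
  have hμ : 0 < (lam * σ) ^ 2 := by positivity
  have hmem := hess.1
  simp only [Set.mem_ofPred_eq, hsq] at hmem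
  have hle : s₀ ≤ (supp β).card := by
    refine hess.2 ?_
    simp only [Set.mem_ofPred_eq, hsq]
    rw [← Finset.sum_subset (Finset.subset_univ (supp β)) fun j _ hj => by
      simp [eq_zero_of_notMem_supp hj, hμ.le], ← nsmul_eq_mul]
    exact Finset.sum_le_card_nsmul _ _ _ fun _ _ => min_le_right _ _
  obtain ⟨T, hTs, hTc, hT⟩ := exists_top_subset (fun j => β j ^ 2) (supp β) hle
  refine ⟨T, hTs, hTc, le_trans ?_ hmem⟩
  have hsmall : ∀ j ∈ Tᶜ, β j ^ 2 ≤ (lam * σ) ^ 2 := by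
    intro j hj
    rw [Finset.mem_compl] at hj
    by_contra! hlt
    have hjs : j ∈ supp β := by
      by_contra h0
      rw [eq_zero_of_notMem_supp h0] at hlt
      nlinarith
    have hge : (insert j T).card • (lam * σ) ^ 2 ≤
        ∑ i ∈ insert j T, min (β i ^ 2) ((lam * σ) ^ 2) := by
      refine Finset.card_nsmul_le_sum _ _ _ fun i hi => ?_
      rw [min_eq_right]
      rcases Finset.mem_insert.1 hi with rfl | hi
      · exact hlt.le
      · exact hlt.le.trans (hT i hi j (Finset.mem_sdiff.2 ⟨hjs, hj⟩))
    have hsub := Finset.sum_le_sum_of_subset_of_nonneg (Finset.subset_univ (insert j T))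
      (f := fun i => min (β i ^ 2) ((lam * σ) ^ 2))
      fun i _ _ => le_min (sq_nonneg (β i)) hμ.le
    rw [Finset.card_insert_of_notMem hj, hTc, nsmul_eq_mul] at hge
    push_cast at hge
    linarith
  calc ∑ j ∈ Tᶜ, β j ^ 2 = ∑ j ∈ Tᶜ, min (β j ^ 2) ((lam * σ) ^ 2) :=
        Finset.sum_congr rfl fun j hj => (min_eq_left (hsmall j hj)).symm
    _ ≤ _ := Finset.sum_le_sum_of_subset_of_nonneg (Finset.subset_univ _)
        fun i _ _ => le_min (sq_nonneg (β i)) hμ.le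

/-- Restricted orthogonality from sparse eigenvalues, by polarization. -/
lemma abs_dotProduct_mulVec_le {n p : ℕ} (hn : 0 < n) {X : Matrix (Fin n) (Fin p) ℝ} {m : ℕ}
    {Lmax Lmin : ℝ} (hmax : IsLambdaMax X m Lmax) (hmin : IsLambdaMin X m Lmin)
    {T T' : Finset (Fin p)} (hd : Disjoint T T') (hc : (T ∪ T').card ≤ m) (u w : Fin p → ℝ)
    (hu : ∀ j, j ∉ T → u j = 0) (hw : ∀ j, j ∉ T' → w j = 0) :
    (X *ᵥ u) ⬝ᵥ (X *ᵥ w) / n ≤ (Lmax - Lmin) / 2 * (l2 u * l2 w) := by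
  have hn' : (0 : ℝ) < n := Nat.cast_pos.2 hn
  have hdot : u ⬝ᵥ w = 0 := by
    refine Finset.sum_eq_zero fun j _ => ?_
    by_cases hj : j ∈ T
    · rw [hw j (Finset.disjoint_left.1 hd hj), mul_zero]
    · rw [hu j hj, zero_mul]
  rcases (l2_nonneg u).eq_or_lt with h0 | hu0
  · rw [l2_eq_zero h0.symm]
    simp [l2]
  rcases (l2_nonneg w).eq_or_lt with h0 | hw0
  · rw [l2_eq_zero h0.symm]
    simp [l2]
  have hcomb : ∀ α γ : ℝ, (supp (α • u + γ • w)).card ≤ m ∧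
      l2 (α • u + γ • w) ^ 2 = α ^ 2 * l2 u ^ 2 + γ ^ 2 * l2 w ^ 2 ∧
      l2 (X *ᵥ (α • u + γ • w)) ^ 2 = α ^ 2 * l2 (X *ᵥ u) ^ 2 +
        2 * (α * γ) * ((X *ᵥ u) ⬝ᵥ (X *ᵥ w)) + γ ^ 2 * l2 (X *ᵥ w) ^ 2 := by
    intro α γ
    refine ⟨(Finset.card_le_card (supp_subset fun j hj => ?_)).trans hc, ?_, ?_⟩
    · rw [Finset.mem_union, not_or] at hj
      simp [hu j hj.1, hw j hj.2]
    · simp only [l2_sq_eq_dotProduct, add_dotProduct, dotProduct_add, smul_dotProduct,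
        dotProduct_smul, smul_eq_mul, dotProduct_comm w u, hdot]
      ring
    · simp only [mulVec_add, mulVec_smul, l2_sq_eq_dotProduct, add_dotProduct, dotProduct_add,
        smul_dotProduct, dotProduct_smul, smul_eq_mul, dotProduct_comm (X *ᵥ w) (X *ᵥ u)]
      ring
  obtain ⟨c1, a1, b1⟩ := hcomb (l2 w) (l2 u)
  obtain ⟨c2, a2, b2⟩ := hcomb (l2 w) (-l2 u)
  have h1 := hmax.le_mul hn c1
  have h2 := hmin.mul_le hn c2
  rw [a1, b1, div_le_iff₀ hn'] at h1
  rw [a2, b2, le_div_iff₀ hn'] at h2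
  rw [div_le_iff₀ hn']
  refine le_of_mul_le_mul_left ?_ (mul_pos hu0 hw0)
  nlinarith

lemma olsRefit_of_notMem {n p : ℕ} (X : Matrix (Fin n) (Fin p) ℝ) (Y : Fin n → ℝ)
    {I : Finset (Fin p)} {j : Fin p} (hj : j ∉ I) : olsRefit X Y I j = 0 := by
  simp [olsRefit, hj]

lemma colSub_mulVec {n p : ℕ} (X : Matrix (Fin n) (Fin p) ℝ) {I : Finset (Fin p)}
    {v : Fin p → ℝ} (hv : ∀ j, j ∉ I → v j = 0) :
    colSub X I *ᵥ (fun j => v j.1) = X *ᵥ v := by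
  funext i
  simp only [mulVec, dotProduct, colSub, Matrix.of_apply]
  rw [Finset.sum_coe_sort I (fun j => X i j * v j)]
  exact Finset.sum_subset (Finset.subset_univ I) fun j _ hj => by simp [hv j hj]

lemma gramInvertible_of_lambdaMin {n p : ℕ} (hn : 0 < n) {X : Matrix (Fin n) (Fin p) ℝ} {m : ℕ}
    {L : ℝ} (hL : IsLambdaMin X m L) (hpos : 0 < L) {I : Finset (Fin p)} (hI : I.card ≤ m) :
    GramInvertible X I := by
  rw [GramInvertible, isUnit_iff_ne_zero]
  intro hdet
  obtain ⟨z, hz0, hz⟩ := Matrix.exists_mulVec_eq_zero_iff.2 hdet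
  set v : Fin p → ℝ := fun j => if h : j ∈ I then z ⟨j, h⟩ else 0 with hv
  have hvI : ∀ j, j ∉ I → v j = 0 := fun j hj => by simp [hv, hj]
  have hzv : z = fun j => v j.1 := by
    funext j
    simp [hv]
  have hX : l2 (X *ᵥ v) ^ 2 = 0 := by
    rw [l2_sq_eq_dotProduct, ← colSub_mulVec X hvI, ← hzv, dotProduct_mulVec,
      ← mulVec_transpose, mulVec_mulVec, hz, zero_dotProduct]
  have h := hL.mul_le hn ((Finset.card_le_card (supp_subset hvI)).trans hI)
  rw [hX, zero_div] at h
  have h0 : l2 v = 0 := by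
    have : l2 v ^ 2 ≤ 0 := nonpos_of_mul_nonpos_right h hpos
    exact pow_eq_zero_iff two_ne_zero |>.1 (le_antisymm this (sq_nonneg _))
  apply hz0
  rw [hzv, l2_eq_zero h0]
  rfl

/-- The normal equations of the refit. -/
lemma GramInvertible.normal_equations {n p : ℕ} {X : Matrix (Fin n) (Fin p) ℝ}
    {I : Finset (Fin p)} (h : GramInvertible X I) (Y : Fin n → ℝ) {u : Fin p → ℝ}
    (hu : ∀ j, j ∉ I → u j = 0) : (Y - X *ᵥ olsRefit X Y I) ⬝ᵥ (X *ᵥ u) = 0 := by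
  set A := colSub X I with hA
  have hX : X *ᵥ olsRefit X Y I = A *ᵥ ((Aᵀ * A)⁻¹ *ᵥ (Aᵀ *ᵥ Y)) := by
    rw [← colSub_mulVec X fun j hj => olsRefit_of_notMem X Y hj]
    congr 1
    funext j
    simp [olsRefit, hA]
  rw [← colSub_mulVec X hu, dotProduct_mulVec, ← mulVec_transpose, hX, mulVec_sub,
    mulVec_mulVec, mulVec_mulVec, Matrix.mul_nonsing_inv _ h, one_mulVec, sub_self,
    zero_dotProduct]

/-- Error of the refit on the selected coordinates. -/
lemma lambdaMin_mul_l2_ols_le {n p : ℕ} (hn : 0 < n) {X : Matrix (Fin n) (Fin p) ℝ} {m m' : ℕ}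
    {Lmax Lmin L M : ℝ} (hmax : IsLambdaMax X m Lmax) (hmin : IsLambdaMin X m Lmin)
    (hL : IsLambdaMin X m' L) (hpos : 0 < L) {I : Finset (Fin p)} (hI : I.card ≤ m')
    {β : Fin p → ℝ} {ε : Fin n → ℝ} (hIS : (I ∪ supp β).card ≤ m) (hM : 0 ≤ M)
    (hnoise : ∀ j, |(∑ i, X i j * ε i) / n| ≤ M) :
    L * l2 (restr (olsRefit X (X *ᵥ β + ε) I - β) I) ≤
      (Lmax - Lmin) / 2 * l2 (restr β Iᶜ) + M * Real.sqrt m' := by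
  set Y := X *ᵥ β + ε with hY
  set e := olsRefit X Y I - β with he
  set u := restr e I with hu
  set w := restr β Iᶜ with hw
  have huI : ∀ j, j ∉ I → u j = 0 := fun _ => restr_of_notMem e
  have hne := (gramInvertible_of_lambdaMin hn hL hpos hI).normal_equations Y huI
  have hdec : Y - X *ᵥ olsRefit X Y I = X *ᵥ w + ε - X *ᵥ u := by
    have : olsRefit X Y I = u + β - w := by
      funext j
      by_cases hj : j ∈ I
      · simp [hu, hw, he, restr, hj]
      · simp [hu, hw, restr, hj, olsRefit_of_notMem]
    rw [this, mulVec_sub, mulVec_add, hY]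
    abel
  rw [hdec, sub_dotProduct, add_dotProduct, ← l2_sq_eq_dotProduct, dotProduct_comm (X *ᵥ w)]
    at hne
  have hunion : I ∪ (supp β \ I) = I ∪ supp β := Finset.union_sdiff_self_eq_union
  have h1 := abs_dotProduct_mulVec_le hn hmax hmin (T := I) (T' := supp β \ I)
    Finset.disjoint_sdiff (by rwa [hunion]) u w huI (fun j hj => by
      by_cases hjI : j ∈ I
      · simp [hw, restr, hjI]
      · simp only [Finset.mem_sdiff, not_and_not_right] at hj
        have : j ∉ supp β := fun h => hjI (hj h)
        simp [hw, restr, eq_zero_of_notMem_supp this])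
  have h2 := dotProduct_mulVec_div_le hnoise u
  have h3 : l1 u ≤ Real.sqrt m' * l2 u :=
    (l1_restr_le e I).trans (mul_le_mul_of_nonneg_right
      (Real.sqrt_le_sqrt (Nat.cast_le.2 hI)) (l2_nonneg _))
  have h4 := hL.mul_le hn ((card_supp_restr_le e I).trans hI)
  have h5 : l2 (X *ᵥ u) ^ 2 / n = (X *ᵥ u) ⬝ᵥ (X *ᵥ w) / n + ε ⬝ᵥ (X *ᵥ u) / n := by
    rw [← add_div]
    congr 1
    linarith
  have h6 := mul_le_mul_of_nonneg_left h3 hM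
  rcases (l2_nonneg u).eq_or_lt with h0 | h0
  · rw [← h0, mul_zero]
    have hLL : Lmin ≤ Lmax := hmax.2 (Set.mem_insert_of_mem _ hmin.1)
    exact add_nonneg (mul_nonneg (by linarith) (l2_nonneg _)) (mul_nonneg hM (Real.sqrt_nonneg _))
  · refine le_of_mul_le_mul_right ?_ h0
    nlinarith

/-- A coordinate block of `β` killed by thresholding `b` at level `t`. -/
lemma l2_restr_sdiff_le {p : ℕ} {β b : Fin p → ℝ} {T I : Finset (Fin p)} {t : ℝ} (ht : 0 ≤ t)
    (hI : ∀ j, j ∉ I → |b j| ≤ t) :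
    l2 (restr β (T \ I)) ≤ l2 (restr (b - restr β T) T) + t * Real.sqrt T.card := by
  have hdec : restr β (T \ I) = -restr (b - restr β T) (T \ I) + restr b (T \ I) := by
    funext j
    by_cases hj : j ∈ T \ I
    · simp [restr, hj, (Finset.mem_sdiff.1 hj).1]
    · simp [restr, hj]
  rw [hdec]
  refine (l2_add_le _ _).trans (add_le_add ?_ ?_)
  · rw [l2_neg]
    refine le_of_sq_le_sq ?_ (l2_nonneg _)
    rw [l2_restr_sq, l2_restr_sq]
    exact Finset.sum_le_sum_of_subset_of_nonneg Finset.sdiff_subset fun _ _ _ => sq_nonneg _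
  · refine le_of_sq_le_sq ?_ (by positivity)
    rw [l2_restr_sq, mul_pow, Real.sq_sqrt (Nat.cast_nonneg _)]
    calc ∑ j ∈ T \ I, b j ^ 2 ≤ (T \ I).card • t ^ 2 :=
          Finset.sum_le_card_nsmul _ _ _ fun j hj =>
            sq_le_sq.2 ((hI j (Finset.mem_sdiff.1 hj).2).trans (le_abs_self t))
      _ ≤ t ^ 2 * T.card := by
          rw [nsmul_eq_mul, mul_comm]
          gcongr
          exact Finset.sdiff_subset

/-- Combination of the refit error on the selected set with the discarded coordinates. -/
lemma refit_error_bound {L d K C D S N U Δ τ m lam σ : ℝ} (hL : 0 < L) (hDC : 0 ≤ D * C)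
    (hm : 0 ≤ m) (hd : 2 * τ ≤ d) (hτ : 0 ≤ τ) (hKL : 1 ≤ 2 * K ^ 2 * L)
    (hC : 4 * d * K ^ 2 ≤ C) (hU : 0 ≤ U)
    (hN : N ^ 2 ≤ ((D + C) ^ 2 + 1) * (m * (lam * σ) ^ 2)) (hS : S ^ 2 = 2 * m)
    (hols : L * U ≤ Δ / 2 * N + σ * τ * lam * S) :
    U ^ 2 + N ^ 2 ≤
      ((D + C) ^ 2 + 1) * (3 / 2 + Δ ^ 2 / (2 * L ^ 2)) * m * lam ^ 2 * σ ^ 2 := by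
  have hnoise : 4 * (σ * τ * lam) ^ 2 ≤ (C ^ 2 / 4 * L ^ 2) * (lam * σ) ^ 2 := by
    have h1 : 2 * τ ≤ C / 2 * L := by
      have h2 := mul_le_mul_of_nonneg_left hKL (show 0 ≤ d by linarith)
      have h3 := mul_le_mul_of_nonneg_right hC hL.le
      linarith
    have h4 := pow_le_pow_left₀ (by positivity) h1 2
    have h5 := mul_le_mul_of_nonneg_right h4 (sq_nonneg (lam * σ))
    linarith
  set W := (D + C) ^ 2 + 1 with hW
  set ρ := m * (lam * σ) ^ 2 with hρ
  have hρ0 : 0 ≤ ρ := by positivity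
  have hU2 : U ^ 2 ≤ Δ ^ 2 / (2 * L ^ 2) * N ^ 2 + C ^ 2 / 4 * ρ := by
    have h1 := pow_le_pow_left₀ (mul_nonneg hL.le hU) hols 2
    have h3 := mul_le_mul_of_nonneg_left hnoise hm
    have h4 : L ^ 2 * U ^ 2 ≤ Δ ^ 2 / 2 * N ^ 2 + C ^ 2 / 4 * L ^ 2 * ρ := by
      have h5 := h1.trans (add_sq_le (a := Δ / 2 * N))
      rw [mul_pow (σ * τ * lam), hS] at h5
      rw [hρ]
      linarith
    refine le_of_mul_le_mul_left (h4.trans (le_of_eq ?_)) (pow_pos hL 2)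
    field_simp
  have hWC : C ^ 2 / 4 ≤ W / 2 := by
    rw [hW]
    nlinarith [sq_nonneg D, sq_nonneg C]
  have hq : 0 ≤ Δ ^ 2 / (2 * L ^ 2) := by positivity
  calc U ^ 2 + N ^ 2 ≤ (1 + Δ ^ 2 / (2 * L ^ 2)) * N ^ 2 + C ^ 2 / 4 * ρ := by linarith
    _ ≤ (1 + Δ ^ 2 / (2 * L ^ 2)) * (W * ρ) + W / 2 * ρ := by gcongr
    _ = W * (3 / 2 + Δ ^ 2 / (2 * L ^ 2)) * m * lam ^ 2 * σ ^ 2 := by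
        rw [hρ]
        ring

/-- Ideal model selection for the Thresholded Lasso. -/
theorem statement_0
    (n p s s₀ : ℕ) (hn : 0 < n) (hp : 0 < p) (hs : 0 < s) (h2s : 2 * s ≤ p)
    (X : Matrix (Fin n) (Fin p) ℝ)
    (hcols : ∀ j, l2 (fun i => X i j) = Real.sqrt n)
    (β : Fin p → ℝ) (hβ : (supp β).card ≤ s)
    (ε Y : Fin n → ℝ) (hY : Y = X.mulVec β + ε)
    (σ a lam : ℝ) (hσ : 0 < σ) (ha : 0 ≤ a)
    (hlam : lam = Real.sqrt (2 * Real.log p / n))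
    (hnoise : ∀ j, |(∑ i, X i j * ε i) / n| ≤ σ * Real.sqrt (1 + a) * lam)
    (hs₀ : 1 ≤ s₀) (hess : EssSparsity β lam σ s₀)
    (K1 K3 K4 : ℝ)
    (hRE1 : RECond X s₀ 1 K1) (hRE3 : RECond X s₀ 3 K3) (hRE4 : RECond X s₀ 4 K4)
    (Lmax2s Lmaxss0 Lmaxs0 Lmin2s Lmin2s0 θ : ℝ)
    (hLmax2s : IsLambdaMax X (2 * s) Lmax2s)
    (hLmaxss0 : IsLambdaMax X (s - s₀) Lmaxss0)
    (hLmaxs0 : IsLambdaMax X s₀ Lmaxs0)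
    (hLmin2s : IsLambdaMin X (2 * s) Lmin2s) (hLmin2spos : 0 < Lmin2s)
    (hLmin2s0 : IsLambdaMin X (2 * s₀) Lmin2s0)
    (hθ : IsTheta X s₀ (2 * s₀) θ)
    (d₀ : ℝ) (hd₀ : 2 * Real.sqrt (1 + a) ≤ d₀)
    (βinit : Fin p → ℝ) (hinit : IsLassoSol X Y (d₀ * lam * σ) βinit)
    (ell D D₀' D₁ : ℝ)
    (hell : ell = min (θ / Real.sqrt Lmin2s0) (Real.sqrt Lmaxs0))
    (hD : D = Real.sqrt (Lmaxss0 / Lmin2s0) * (1 + 3 * ell * Real.sqrt Lmaxss0 / d₀))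
    (hD₀' : D₀' = max D (max (d₀ * K4 ^ 2) (K3 * Real.sqrt Lmaxss0 + 3 * d₀ * K3 ^ 2)))
    (hD₁ : D₁ = max (Lmaxss0 / d₀ + (9 / 4) * d₀ * K3 ^ 2)
      (max (4 * d₀ * K4 ^ 2) (3 * Lmaxss0 / d₀)))
    (C₄ t₀ : ℝ) (hC₄ : max D₁ (2 * Real.sqrt (1 + a)) ≤ C₄)
    (ht₀ : t₀ = C₄ * lam * σ)
    (I : Finset (Fin p)) (hI : I = Finset.univ.filter fun j => t₀ ≤ |βinit j|)
    (βhat : Fin p → ℝ) (hβhat : βhat = olsRefit X Y I) :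
    (I.card : ℝ) ≤ s₀ * (1 + D₁ / C₄) ∧ (s₀ : ℝ) * (1 + D₁ / C₄) ≤ 2 * s₀ ∧
    ((I ∪ supp β).card : ℝ) ≤ s + s₀ ∧
    (l2 (βhat - β)) ^ 2 ≤
      ((D₀' + C₄) ^ 2 + 1) * (3 / 2 + (Lmax2s - Lmin2s) ^ 2 / (2 * Lmin2s0 ^ 2)) *
        s₀ * lam ^ 2 * σ ^ 2 := by
  have hsn : 0 < Real.sqrt n := Real.sqrt_pos.2 (Nat.cast_pos.2 hn)
  have hlampos : 0 < lam := by
    have hp1 : (1 : ℝ) < p := by exact_mod_cast (by omega : 1 < p)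
    rw [hlam]
    exact Real.sqrt_pos.2 (div_pos (mul_pos two_pos (Real.log_pos hp1)) (Nat.cast_pos.2 hn))
  have hμ : 0 < lam * σ := mul_pos hlampos hσ
  have h1a : 1 ≤ Real.sqrt (1 + a) := Real.one_le_sqrt.2 (by linarith)
  have hd : 0 < d₀ := by linarith
  have hC₄D : D₁ ≤ C₄ := (le_max_left _ _).trans hC₄
  have hC₄pos : 0 < C₄ := by linarith [(le_max_right _ _).trans hC₄]
  have hs₀pos : (0 : ℝ) < s₀ := Nat.cast_pos.2 hs₀
  have hr : 0 < Real.sqrt s₀ := Real.sqrt_pos.2 hs₀pos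
  have hr2 : Real.sqrt s₀ ^ 2 = s₀ := Real.sq_sqrt hs₀pos.le
  have hA := hLmaxss0.nonneg
  have hE2 : Real.sqrt Lmaxss0 ^ 2 = Lmaxss0 := Real.sq_sqrt hA
  have hKL := hLmin2s0.one_le_mul hRE4 (by norm_num)
  have hLpos : 0 < Lmin2s0 := by
    by_contra! h
    nlinarith [sq_nonneg K4]
  have hL : 0 < Real.sqrt Lmin2s0 := Real.sqrt_pos.2 hLpos
  have hell0 : 0 ≤ ell := hell ▸ le_min (div_nonneg hθ.1.1 hL.le) (Real.sqrt_nonneg _)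
  obtain ⟨T, hTs, hTc, hTtail⟩ := hess.exists_topSet hμ
  have hs₀s : s₀ ≤ s := hTc ▸ (Finset.card_le_card hTs).trans hβ
  set h := βinit - restr β T with hh
  subst hY
  have hbasic := hinit.basic_inequality (by positivity) (fun j => (hnoise j).trans (by
    nlinarith [mul_le_mul_of_nonneg_right hd₀ hμ.le])) T
  rw [← hh] at hbasic
  set x := l2 (X *ᵥ h) / Real.sqrt n with hx
  have hx0 : 0 ≤ x := div_nonneg (l2_nonneg _) hsn.le
  have hG : l2 (X *ᵥ restr β Tᶜ) / Real.sqrt n ≤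
      Real.sqrt Lmaxss0 * (Real.sqrt s₀ * (lam * σ)) := by
    refine le_of_sq_le_sq ?_ (by positivity)
    have hg : restr β Tᶜ = restr β (supp β \ T) := by
      funext j
      by_cases hj : j ∈ supp β
      · simp [restr, hj]
      · simp [restr, hj, eq_zero_of_notMem_supp hj]
    have hgc : (supp (restr β Tᶜ)).card ≤ s - s₀ := by
      rw [hg]
      refine (card_supp_restr_le _ _).trans ?_
      rw [Finset.card_sdiff_of_subset hTs]
      omega
    rw [div_sqrt_sq, mul_pow, mul_pow, hE2, hr2]
    refine (hLmaxss0.le_mul hn hgc).trans (mul_le_mul_of_nonneg_left ?_ hA)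
    rw [l2_restr_sq]
    exact hTtail
  have hbasic' : 2 * x ^ 2 + d₀ * (lam * σ) * l1 (restr h Tᶜ) ≤
      3 * (d₀ * (lam * σ)) * l1 (restr h T) +
        2 * (x * (Real.sqrt Lmaxss0 * (Real.sqrt s₀ * (lam * σ)))) := by
    have := mul_le_mul_of_nonneg_left hG hx0
    linarith
  have hP : l1 (restr h T) ≤ Real.sqrt s₀ * l2 (restr h T) := hTc ▸ l1_restr_le h T
  have hcone₃ : l1 (restr h Tᶜ) ≤ 3 * l1 (restr h T) → l2 (restr h T) ≤ K3 * x := fun hc =>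
    (div_le_iff₀' hRE3.1).1 (hRE3.2 h T hTc.le hc)
  have hcone₄ : l1 (restr h Tᶜ) ≤ 4 * l1 (restr h T) → l2 (restr h T) ≤ K4 * x := fun hc =>
    (div_le_iff₀' hRE4.1).1 (hRE4.2 h T hTc.le hc)
  have hD₁K : 4 * d₀ * K4 ^ 2 ≤ D₁ :=
    hD₁ ▸ (le_max_left _ _).trans (le_max_right _ _)
  have htail : l1 (restr h Tᶜ) ≤ D₁ * (Real.sqrt s₀ ^ 2 * (lam * σ)) := by
    refine tail_bound_of_basic hr hμ hd hP hbasic' hcone₃ hcone₄ ?_ hD₁K ?_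
    · rw [hE2, hD₁]
      exact le_max_left _ _
    · rw [hE2, hD₁]
      exact (le_max_right _ _).trans (le_max_right _ _)
  rw [hr2] at htail
  have hhead : l2 (restr h T) ≤ D₀' * (Real.sqrt s₀ * (lam * σ)) := by
    have hspec := sqrt_lambdaMin_mul_l2_restr_le hn hs₀ (by omega) hLpos hLmin2s0 hLmaxs0 hθ h hTc
    rw [← hell] at hspec
    refine head_bound_of_basic hx0 (l1_nonneg _) hr hμ hd (Real.sqrt_nonneg _) hL hell0 hRE3.1
      hRE4.1 hP hbasic' hcone₃ hcone₄ hspec (hD.trans (by rw [Real.sqrt_div hA])) ?_ ?_ ?_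
    · exact hD₀' ▸ le_max_left _ _
    · exact hD₀' ▸ (le_max_left _ _).trans (le_max_right _ _)
    · exact hD₀' ▸ (le_max_right _ _).trans (le_max_right _ _)
  have ht₀pos : 0 < t₀ := by rw [ht₀]; positivity
  have hcardIT : ((I \ T).card : ℝ) ≤ s₀ * (D₁ / C₄) := by
    have h1 : (I \ T).card • t₀ ≤ ∑ j ∈ I \ T, |h j| := by
      refine Finset.card_nsmul_le_sum _ _ _ fun j hj => ?_
      obtain ⟨hjI, hjT⟩ := Finset.mem_sdiff.1 hj
      rw [hI, Finset.mem_filter] at hjI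
      simpa [hh, restr, hjT] using hjI.2
    have h2 : ∑ j ∈ I \ T, |h j| ≤ l1 (restr h Tᶜ) := by
      rw [l1_restr]
      exact Finset.sum_le_sum_of_subset_of_nonneg
        (fun j hj => Finset.mem_compl.2 (Finset.mem_sdiff.1 hj).2) fun _ _ _ => abs_nonneg _
    have h3 := (h1.trans h2).trans htail
    rw [nsmul_eq_mul, ht₀] at h3
    rw [← mul_div_assoc, le_div_iff₀ hC₄pos]
    refine le_of_mul_le_mul_right ?_ hμ
    linarith
  have hD₁C₄ : D₁ / C₄ ≤ 1 := (div_le_one hC₄pos).2 hC₄D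
  have hcardI : (I.card : ℝ) ≤ s₀ * (1 + D₁ / C₄) := by
    have h1 : I.card ≤ T.card + (I \ T).card := by
      have := Finset.card_le_card_sdiff_add_card (s := I) (t := T)
      omega
    have h2 : (I.card : ℝ) ≤ s₀ + (I \ T).card := by
      rw [hTc] at h1
      exact_mod_cast h1
    linarith
  have hcard2 : (s₀ : ℝ) * (1 + D₁ / C₄) ≤ 2 * s₀ := by
    linarith [mul_le_mul_of_nonneg_left hD₁C₄ hs₀pos.le]
  have hcardIS : ((I ∪ supp β).card : ℝ) ≤ s + s₀ := by
    have h1 : I ∪ supp β ⊆ supp β ∪ (I \ T) := by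
      intro j hj
      simp only [Finset.mem_union, Finset.mem_sdiff] at hj ⊢
      by_cases hjT : j ∈ T
      · exact Or.inl (hTs hjT)
      · tauto
    have h2 : (I ∪ supp β).card ≤ s + (I \ T).card :=
      (Finset.card_le_card h1).trans ((Finset.card_union_le _ _).trans (by omega))
    have h3 : ((I ∪ supp β).card : ℝ) ≤ s + (I \ T).card := by exact_mod_cast h2
    linarith [mul_le_mul_of_nonneg_left hD₁C₄ hs₀pos.le]
  refine ⟨hcardI, hcard2, hcardIS, ?_⟩
  have hI2 : I.card ≤ 2 * s₀ := by exact_mod_cast hcardI.trans hcard2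
  have hIS2 : (I ∪ supp β).card ≤ 2 * s := by
    have : (I ∪ supp β).card ≤ s + s₀ := by exact_mod_cast hcardIS
    omega
  have hols := lambdaMin_mul_l2_ols_le hn hLmax2s hLmin2s hLmin2s0 hLpos hI2 hIS2
    (by positivity) hnoise
  rw [← hβhat] at hols
  have hD₀'0 : 0 ≤ D₀' := by
    have h1 : d₀ * K4 ^ 2 ≤ D₀' := hD₀' ▸ (le_max_left _ _).trans (le_max_right _ _)
    exact le_trans (by positivity) h1
  have hoff : l2 (restr β Iᶜ) ^ 2 ≤ ((D₀' + C₄) ^ 2 + 1) * (s₀ * (lam * σ) ^ 2) := by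
    have h1 : l2 (restr β (T \ I)) ≤ (D₀' + C₄) * (Real.sqrt s₀ * (lam * σ)) := by
      have h2 := l2_restr_sdiff_le (β := β) (b := βinit) (T := T) (I := I) ht₀pos.le (fun j hj => by
        simp only [hI, Finset.mem_filter, Finset.mem_univ, true_and, not_le] at hj
        exact hj.le)
      rw [← hh, hTc, ht₀] at h2
      linarith
    have h3 := pow_le_pow_left₀ (l2_nonneg _) h1 2
    rw [mul_pow, mul_pow, hr2, l2_restr_sq] at h3
    have h4 : ∑ j ∈ Iᶜ, β j ^ 2 ≤ ∑ j ∈ T \ I, β j ^ 2 + ∑ j ∈ Tᶜ, β j ^ 2 := by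
      have hsub : T \ I ⊆ Iᶜ := fun j hj => Finset.mem_compl.2 (Finset.mem_sdiff.1 hj).2
      rw [← Finset.sum_sdiff hsub, add_comm]
      gcongr
      intro j hj
      simp only [Finset.mem_sdiff, Finset.mem_compl] at hj ⊢
      tauto
    rw [l2_restr_sq]
    linarith
  have hsplit : l2 (βhat - β) ^ 2 = l2 (restr (βhat - β) I) ^ 2 + l2 (restr β Iᶜ) ^ 2 := by
    rw [l2_sq_eq_restr_add (βhat - β) I, l2_restr_sq _ Iᶜ, l2_restr_sq _ Iᶜ]
    congr 1
    refine Finset.sum_congr rfl fun j hj => ?_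
    simp [hβhat, olsRefit_of_notMem X _ (Finset.mem_compl.1 hj)]
  have hS : Real.sqrt ((2 * s₀ : ℕ) : ℝ) ^ 2 = 2 * s₀ := by
    rw [Real.sq_sqrt (Nat.cast_nonneg _)]
    push_cast
    ring
  rw [hsplit]
  exact refit_error_bound hLpos (mul_nonneg hD₀'0 hC₄pos.le) (Nat.cast_nonneg s₀)
    hd₀ (Real.sqrt_nonneg _) hKL (hD₁K.trans hC₄D) (l2_nonneg _) hoff hS hols

end ThreshLasso
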